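/- arXiv:1011.1403 — 4 statements merged into one kernel-verified Lean document; each statement's English description precedes it below -/
import Mathlib

section
/- Let m, n be integers with m ≥ n ≥ 1 and let β > 1 be the positive root of x² - mx - n. Then the set Fin(-β) is closed under addition: for all x, y ∈ Fin(-β), x + y ∈ Fin(-β). -/
/-- The Ito–Sadahiro transformation `T_{-β}` on `[l_β, r_β)`, where
`l_β = -β/(β+1)` and `r_β = 1/(β+1)`. -/
noncomputable def negT (β : ℝ) (x : ℝ) : ℝ :=
  -β * x - (⌊-β * x - (-β / (β + 1))⌋ : ℝ)

/-- `Fin(-β)`: reals `x` such that `(-β)^k * x ∈ (l_β, r_β)` for some `k : ℤ`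
and some iterate of `T_{-β}` sends it to `0`. -/
def negFin (β : ℝ) (x : ℝ) : Prop :=
  ∃ (k : ℤ) (n : ℕ), ((-β) ^ k * x ∈ Set.Ioo (-β / (β + 1)) (1 / (β + 1))) ∧
    (negT β)^[n] ((-β) ^ k * x) = 0

/-- The set `ℤ_{-β}` of `(-β)`-integers. -/
def negInt (β : ℝ) (x : ℝ) : Prop :=
  x = 0 ∨ ∃ (N : ℕ) (y : ℝ), y ∈ Set.Ioo (-β / (β + 1)) (1 / (β + 1)) ∧
    x = (-β) ^ (N + 1) * y ∧ (negT β)^[N + 1] y = 0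

/-- The `(-β)`-digit `d_{i+1}(y)` of `y ∈ [l_β, r_β)` (indices shifted so that
`negDigit β y i` is the digit `d_{i+1}(y)`). -/
noncomputable def negDigit (β : ℝ) (y : ℝ) (i : ℕ) : ℤ :=
  ⌊-β * ((negT β)^[i] y) - (-β / (β + 1))⌋

/-- The golden ratio `τ = (1+√5)/2`. -/
noncomputable def tau : ℝ := (1 + Real.sqrt 5) / 2

/-- The Rényi transformation `T_β` on `[0,1)`. -/
noncomputable def renyiT (β : ℝ) (x : ℝ) : ℝ := β * x - (⌊β * x⌋ : ℝ)

/-- The set `ℤ_β` of (nonnegative) `β`-integers. -/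
def posInt (β : ℝ) (x : ℝ) : Prop :=
  x = 0 ∨ ∃ N : ℕ, (β ^ (-(N + 1 : ℤ)) * x ∈ Set.Ico (0 : ℝ) 1) ∧
    (renyiT β)^[N + 1] (β ^ (-(N + 1 : ℤ)) * x) = 0

/-- Sums `∑ i ∈ [1, N], eᵢ (-β)⁻ⁱ` with integer digits `0 ≤ eᵢ < n`. -/
def negFrac (n : ℤ) (β : ℝ) : ℕ → Set ℝ
  | 0 => {0}
  | N + 1 => {w | ∃ e : ℤ, 0 ≤ e ∧ e < n ∧ ∃ f ∈ negFrac n β N, w = (e + f) / (-β)}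

/-- Numbers `A + B (-β) + f` with `A, B` nonnegative integers and `f ∈ negFrac n β N`. -/
def negCone (n : ℤ) (β : ℝ) (N : ℕ) : Set ℝ :=
  {w | ∃ A B : ℤ, 0 ≤ A ∧ 0 ≤ B ∧ ∃ f ∈ negFrac n β N, w = A + B * (-β) + f}

lemma negT_mem_Ico {β : ℝ} (hβ : 1 < β) (x : ℝ) :
    negT β x ∈ Set.Ico (-β / (β + 1)) (1 / (β + 1)) := by
  have h1 := Int.floor_le (-β * x - (-β / (β + 1)))
  have h2 := Int.lt_floor_add_one (-β * x - (-β / (β + 1)))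
  have h3 : 1 / (β + 1) = -β / (β + 1) + 1 := by
    have : β + 1 ≠ 0 := by positivity
    field_simp
    ring
  rw [negT]
  constructor <;> linarith

lemma lt_of_root {m n : ℤ} (hn : 1 ≤ n) {β : ℝ} (hβ : 1 < β)
    (hroot : β ^ 2 - (m : ℝ) * β - (n : ℝ) = 0) : (m : ℝ) < β := by
  have : (1 : ℝ) ≤ n := by exact_mod_cast hn
  by_contra! h
  nlinarith

lemma negFrac_mem_Ioo {n : ℤ} {β : ℝ} (hβ : 1 < β) (hnβ : (n : ℝ) < β) {N : ℕ} {f : ℝ}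
    (hf : f ∈ negFrac n β N) : f ∈ Set.Ioo (-β / (β + 1)) (1 / (β + 1)) := by
  have hb : 0 < β + 1 := by positivity
  induction N generalizing f with
  | zero =>
    obtain rfl : f = 0 := hf
    exact ⟨div_neg_of_neg_of_pos (by linarith) hb, by positivity⟩
  | succ N ih =>
    obtain ⟨e, he0, hen, f, hf, rfl⟩ := hf
    obtain ⟨h1, h2⟩ := ih hf
    rw [div_lt_iff₀ hb] at h1
    rw [lt_div_iff₀ hb] at h2
    have he0' : (0 : ℝ) ≤ e := by exact_mod_cast he0
    have hen' : (e : ℝ) + 1 ≤ n := by exact_mod_cast hen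
    rw [div_neg, ← neg_div]
    constructor
    · rw [div_lt_div_iff₀ hb (by positivity)]
      nlinarith
    · rw [div_lt_div_iff₀ (by positivity) hb]
      nlinarith

lemma negFrac_succ {n : ℤ} (hn : 1 ≤ n) {β : ℝ} {N : ℕ} {f : ℝ} (hf : f ∈ negFrac n β N) :
    f ∈ negFrac n β (N + 1) := by
  induction N generalizing f with
  | zero =>
    obtain rfl : f = 0 := hf
    exact ⟨0, le_rfl, by lia, 0, rfl, by simp⟩
  | succ N ih =>
    obtain ⟨e, he0, hen, f, hf, rfl⟩ := hf
    exact ⟨e, he0, hen, f, ih hf, rfl⟩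

lemma negCone_mono {n : ℤ} (hn : 1 ≤ n) (β : ℝ) : Monotone (negCone n β) :=
  monotone_nat_of_le_succ fun _ _ ⟨A, B, hA, hB, f, hf, h⟩ =>
    ⟨A, B, hA, hB, f, negFrac_succ hn hf, h⟩

lemma intCast_add_mem_negCone {n : ℤ} {β : ℝ} {N : ℕ} {w : ℝ} (hw : w ∈ negCone n β N) {d : ℤ}
    (hd : 0 ≤ d) : d + w ∈ negCone n β N := by
  obtain ⟨A, B, hA, hB, f, hf, rfl⟩ := hw
  exact ⟨d + A, B, by lia, hB, f, hf, by push_cast; ring⟩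

lemma div_mem_negCone {m n : ℤ} (hn : 1 ≤ n) (hm : 0 ≤ m) {β : ℝ} (hβ : 1 < β)
    (hroot : β ^ 2 - (m : ℝ) * β - (n : ℝ) = 0) {N : ℕ} {w : ℝ} (hw : w ∈ negCone n β N) :
    w / (-β) ∈ negCone n β (N + 1) := by
  obtain ⟨A, B, hA, hB, f, hf, rfl⟩ := hw
  have hq : 0 ≤ A / n := Int.ediv_nonneg hA (by lia)
  refine ⟨B + A / n * m, A / n, by positivity, hq, (((A % n : ℤ) : ℝ) + f) / (-β),
    ⟨A % n, Int.emod_nonneg _ (by lia), Int.emod_lt_of_pos _ (by lia), f, hf, rfl⟩, ?_⟩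
  have hA' : (A : ℝ) = n * (A / n : ℤ) + (A % n : ℤ) := by
    exact_mod_cast (Int.mul_ediv_add_emod A n).symm
  have : β ≠ 0 := by positivity
  push_cast
  rw [hA']
  field_simp
  linear_combination ((A / n : ℤ) : ℝ) * hroot

lemma div_pow_mem_negCone {m n : ℤ} (hn : 1 ≤ n) (hm : 0 ≤ m) {β : ℝ} (hβ : 1 < β)
    (hroot : β ^ 2 - (m : ℝ) * β - (n : ℝ) = 0) {N : ℕ} {w : ℝ} (hw : w ∈ negCone n β N) (j : ℕ) :
    w / (-β) ^ j ∈ negCone n β (N + j) := by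
  induction j with
  | zero => simpa using hw
  | succ j ih =>
    rw [pow_succ, ← div_div]
    exact div_mem_negCone hn hm hβ hroot ih

lemma negFrac_add_mem_negCone {m n : ℤ} (hn : 1 ≤ n) (hm : 0 ≤ m) {β : ℝ} (hβ : 1 < β)
    (hroot : β ^ 2 - (m : ℝ) * β - (n : ℝ) = 0) {N : ℕ} {f g : ℝ} (hf : f ∈ negFrac n β N)
    (hg : g ∈ negFrac n β N) : f + g ∈ negCone n β N := by
  induction N generalizing f g with
  | zero =>
    obtain rfl : f = 0 := hf
    obtain rfl : g = 0 := hg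
    exact ⟨0, 0, le_rfl, le_rfl, 0, rfl, by simp⟩
  | succ N ih =>
    obtain ⟨e, he, -, f, hf, rfl⟩ := hf
    obtain ⟨e', he', -, g, hg, rfl⟩ := hg
    convert div_mem_negCone hn hm hβ hroot
      (intCast_add_mem_negCone (ih hf hg) (add_nonneg he he')) using 1
    push_cast
    ring

lemma add_mem_negCone {m n : ℤ} (hn : 1 ≤ n) (hm : 0 ≤ m) {β : ℝ} (hβ : 1 < β)
    (hroot : β ^ 2 - (m : ℝ) * β - (n : ℝ) = 0) {N : ℕ} {v w : ℝ} (hv : v ∈ negCone n β N)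
    (hw : w ∈ negCone n β N) : v + w ∈ negCone n β N := by
  obtain ⟨A, B, hA, hB, f, hf, rfl⟩ := hv
  obtain ⟨A', B', hA', hB', g, hg, rfl⟩ := hw
  obtain ⟨C, D, hC, hD, h, hh, hfg⟩ := negFrac_add_mem_negCone hn hm hβ hroot hf hg
  refine ⟨A + A' + C, B + B' + D, by positivity, by positivity, h, hh, ?_⟩
  push_cast
  linear_combination hfg

lemma mem_negCone_of_iterate_negT_eq_zero {m n : ℤ} (hn : 1 ≤ n) (hm : 0 ≤ m) {β : ℝ}
    (hβ : 1 < β) (hroot : β ^ 2 - (m : ℝ) * β - (n : ℝ) = 0) {k : ℕ} {w : ℝ}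
    (hw : w ∈ Set.Ico (-β / (β + 1)) (1 / (β + 1))) (h : (negT β)^[k] w = 0) :
    w ∈ negCone n β k := by
  induction k generalizing w with
  | zero =>
    obtain rfl : w = 0 := h
    exact ⟨0, 0, le_rfl, le_rfl, 0, rfl, by simp⟩
  | succ k ih =>
    have hd : 0 ≤ ⌊-β * w - (-β / (β + 1))⌋ := by
      have : β * w ≤ β * (1 / (β + 1)) := mul_le_mul_of_nonneg_left hw.2.le (by linarith)
      rw [Int.floor_nonneg, neg_div, div_eq_mul_one_div]
      linarith
    convert div_mem_negCone hn hm hβ hroot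
      (intCast_add_mem_negCone (ih (negT_mem_Ico hβ w) h) hd) using 1
    have : β ≠ 0 := by positivity
    rw [negT, eq_div_iff (by simpa using this)]
    ring

/-- One step of `T_{-β}` applied to `A + B (-β) + (e + f) (-β)⁻¹`, in coordinates. -/
lemma negT_eq_of_mem_Ico {m n : ℤ} (hn : 1 ≤ n) {β : ℝ} (hβ : 1 < β)
    (hroot : β ^ 2 - (m : ℝ) * β - (n : ℝ) = 0) {A B e : ℤ} (hB : 0 ≤ B) (he : 0 ≤ e) {f w : ℝ}
    (hf : f ∈ Set.Ioo (-β / (β + 1)) (1 / (β + 1))) (hwe : w = A + B * (-β) + (e + f) / (-β))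
    (hw : w ∈ Set.Ico (-β / (β + 1)) (1 / (β + 1))) :
    B * m ≤ A ∧ ∃ d : ℤ, 0 ≤ d ∧ d ≤ e + B * n ∧
      negT β w = (e + B * n - d : ℤ) + (A - B * m : ℤ) * (-β) + f := by
  have hb : 0 < β + 1 := by positivity
  have hβ0 : β ≠ 0 := by positivity
  have hm := lt_of_root hn hβ hroot
  have hB' : (0 : ℝ) ≤ B := by exact_mod_cast hB
  have he' : (0 : ℝ) ≤ e := by exact_mod_cast he
  have hlr : 1 / (β + 1) = -β / (β + 1) + 1 := by
    field_simp
    ring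
  have hlβ : -β / (β + 1) = -(β * (1 / (β + 1))) := by
    field_simp
  have hA : B * m ≤ A := by
    have h1 : (e + f) / (-β) < 1 / (β + 1) := by
      rw [div_neg, ← neg_div, div_lt_iff₀ (by positivity)]
      linarith [hf.1]
    have h2 : (B : ℝ) * m ≤ B * β := mul_le_mul_of_nonneg_left hm.le hB'
    have h3 : (B * m : ℝ) < A + 1 := by linarith [hw.1]
    exact_mod_cast Int.lt_add_one_iff.mp (by exact_mod_cast h3)
  have hA' : (0 : ℝ) ≤ A - B * m := by exact_mod_cast sub_nonneg.mpr hA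
  have hz : -β * w = (e + B * n) + (A - B * m) * (-β) + f := by
    rw [hwe]
    field_simp
    linear_combination (B : ℝ) * hroot
  refine ⟨hA, ⌊-β * w - (-β / (β + 1))⌋, ?_, ?_, ?_⟩
  · have : β * w ≤ β * (1 / (β + 1)) := mul_le_mul_of_nonneg_left hw.2.le (by linarith)
    rw [Int.floor_nonneg]
    linarith
  · rw [← Int.lt_add_one_iff, Int.floor_lt, hz]
    push_cast
    have : 0 ≤ ((A : ℝ) - B * m) * β := by positivity
    linarith [hf.2]
  · rw [negT, hz]
    push_cast
    ring

lemma exists_iterate_negT_eq_zero_of_integral {m n : ℤ} (hn : 1 ≤ n) (hmn : n ≤ m) {β : ℝ}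
    (hβ : 1 < β) (hroot : β ^ 2 - (m : ℝ) * β - (n : ℝ) = 0) (s : ℕ) {A B : ℤ} (hA : 0 ≤ A)
    (hB : 0 ≤ B) (hs : A + B ≤ s) {w : ℝ} (hwe : w = A + B * (-β))
    (hw : w ∈ Set.Ico (-β / (β + 1)) (1 / (β + 1))) : ∃ k, (negT β)^[k] w = 0 := by
  have hb : 0 < β + 1 := by positivity
  induction s generalizing A B w with
  | zero =>
    obtain ⟨rfl, rfl⟩ : A = 0 ∧ B = 0 := by lia
    exact ⟨0, by simp [hwe]⟩
  | succ s ih =>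
    rcases hB.eq_or_lt with rfl | hB1
    · have h : (A : ℝ) < 1 := by
        have h1 := hw.2
        rw [lt_div_iff₀ hb] at h1
        have h2 : w = A := by simp [hwe]
        have h3 : (0 : ℝ) ≤ A := by exact_mod_cast hA
        rw [h2] at h1
        nlinarith
      obtain rfl : A = 0 := by
        have : A < 1 := by exact_mod_cast h
        lia
      exact ⟨0, by simp [hwe]⟩
    · obtain ⟨hAB, d, hd0, hd, hT⟩ := negT_eq_of_mem_Ico (A := A) (e := 0) (f := 0) hn hβ hroot hB le_rfl
        ⟨div_neg_of_neg_of_pos (by linarith) hb, by positivity⟩ (by simp [hwe]) hw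
      have hBn : B * n ≤ B * m := mul_le_mul_of_nonneg_left hmn hB
      obtain ⟨k, hk⟩ := ih (A := 0 + B * n - d) (B := A - B * m) (by lia) (by lia)
        (by push_cast at hs; lia) (by rw [hT, add_zero]) (negT_mem_Ico hβ w)
      exact ⟨k + 1, hk⟩

lemma exists_iterate_negT_eq_zero {m n : ℤ} (hn : 1 ≤ n) (hmn : n ≤ m) {β : ℝ} (hβ : 1 < β)
    (hroot : β ^ 2 - (m : ℝ) * β - (n : ℝ) = 0) {N : ℕ} {w : ℝ} (hc : w ∈ negCone n β N)
    (hw : w ∈ Set.Ico (-β / (β + 1)) (1 / (β + 1))) : ∃ k, (negT β)^[k] w = 0 := by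
  have hnβ : (n : ℝ) < β :=
    lt_of_le_of_lt (by exact_mod_cast hmn) (lt_of_root hn hβ hroot)
  induction N generalizing w with
  | zero =>
    obtain ⟨A, B, hA, hB, f, hf, hwe⟩ := hc
    obtain rfl : f = 0 := hf
    exact exists_iterate_negT_eq_zero_of_integral hn hmn hβ hroot (A + B).toNat hA hB (by lia)
      (by simpa using hwe) hw
  | succ N ih =>
    obtain ⟨A, B, hA, hB, _, ⟨e, he, -, f, hf, rfl⟩, hwe⟩ := hc
    obtain ⟨hAB, d, -, hd, hT⟩ := negT_eq_of_mem_Ico hn hβ hroot hB he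
      (negFrac_mem_Ioo hβ hnβ hf) hwe hw
    obtain ⟨k, hk⟩ := ih ⟨e + B * n - d, A - B * m, by lia, by lia, f, hf, hT⟩ (negT_mem_Ico hβ w)
    exact ⟨k + 1, hk⟩

lemma exists_div_pow_mem_Ioo {β : ℝ} (hβ : 1 < β) (w : ℝ) :
    ∃ j : ℕ, w / (-β) ^ j ∈ Set.Ioo (-β / (β + 1)) (1 / (β + 1)) := by
  have hb : 0 < β + 1 := by positivity
  have h : Filter.Tendsto (fun j : ℕ => w * ((-β)⁻¹) ^ j) Filter.atTop (nhds (w * 0)) := by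
    refine (tendsto_pow_atTop_nhds_zero_of_abs_lt_one ?_).const_mul w
    rw [abs_inv, abs_neg, abs_of_pos (by positivity)]
    exact inv_lt_one_of_one_lt₀ hβ
  rw [mul_zero] at h
  obtain ⟨j, hj⟩ := (h.eventually (Ioo_mem_nhds
    (div_neg_of_neg_of_pos (by linarith) hb : -β / (β + 1) < 0) (by positivity : 0 < 1 / (β + 1)))).exists
  exact ⟨j, by rwa [div_eq_mul_inv w, ← inv_pow]⟩

/-- `Fin(-β)` consists of the numbers which some power of `-β` moves into the cone. -/
lemma negFin_iff_exists_mem_negCone {m n : ℤ} (hn : 1 ≤ n) (hmn : n ≤ m) {β : ℝ} (hβ : 1 < β)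
    (hroot : β ^ 2 - (m : ℝ) * β - (n : ℝ) = 0) (x : ℝ) :
    negFin β x ↔ ∃ (k : ℤ) (N : ℕ), (-β) ^ k * x ∈ negCone n β N := by
  have hβ0 : -β ≠ 0 := by linarith
  constructor
  · rintro ⟨k, N, hk, hN⟩
    exact ⟨k, N, mem_negCone_of_iterate_negT_eq_zero hn (by lia) hβ hroot ⟨hk.1.le, hk.2⟩ hN⟩
  · rintro ⟨k, N, h⟩
    obtain ⟨j, hj⟩ := exists_div_pow_mem_Ioo hβ ((-β) ^ k * x)
    obtain ⟨i, hi⟩ := exists_iterate_negT_eq_zero hn hmn hβ hroot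
      (div_pow_mem_negCone hn (by lia) hβ hroot h j) ⟨hj.1.le, hj.2⟩
    have he : (-β) ^ k * x / (-β) ^ j = (-β) ^ (k - j) * x := by
      rw [zpow_sub₀ hβ0, zpow_natCast]
      ring
    rw [he] at hj hi
    exact ⟨k - j, i, hj, hi⟩

/-- For `β > 1` the positive root of `x² - mx - n` with `m ≥ n ≥ 1`,
the set `Fin(-β)` is closed under addition. -/
theorem negFin_closed_under_addition
    (m n : ℤ) (hn : 1 ≤ n) (hmn : n ≤ m) (β : ℝ) (hβ : 1 < β)
    (hroot : β ^ 2 - (m : ℝ) * β - (n : ℝ) = 0)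
    (x y : ℝ) (hx : negFin β x) (hy : negFin β y) :
    negFin β (x + y) := by
  have hβ0 : -β ≠ 0 := by linarith
  have hm : 0 ≤ m := by lia
  rw [negFin_iff_exists_mem_negCone hn hmn hβ hroot] at hx hy ⊢
  obtain ⟨k, N, hk⟩ := hx
  obtain ⟨l, M, hl⟩ := hy
  have shift : ∀ {k : ℤ} {N : ℕ} {z : ℝ}, (-β) ^ k * z ∈ negCone n β N → ∀ j : ℕ,
      (-β) ^ (k - j) * z ∈ negCone n β (N + j) := by
    intro k N z h j
    convert div_pow_mem_negCone hn hm hβ hroot h j using 1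
    rw [zpow_sub₀ hβ0, zpow_natCast]
    ring
  have hk' := shift hk (k - min k l).toNat
  have hl' := shift hl (l - min k l).toNat
  rw [show k - ((k - min k l).toNat : ℤ) = min k l by lia] at hk'
  rw [show l - ((l - min k l).toNat : ℤ) = min k l by lia] at hl'
  refine ⟨min k l, max (N + (k - min k l).toNat) (M + (l - min k l).toNat), ?_⟩
  rw [mul_add]
  exact add_mem_negCone hn hm hβ hroot (negCone_mono hn β (le_max_left _ _) hk')
    (negCone_mono hn β (le_max_right _ _) hl')
end

section
/- For all x, y ∈ ℤ_{-τ}, the number τ²·(x + y) belongs to ℤ_{-τ}; that is, the sum of any two (-τ)-integers has at most two fractional digits in its (-τ)-expansion (L_⊕(-τ) ≤ 2). -/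
lemma tau_sq : tau ^ 2 = tau + 1 := by
  have h : Real.sqrt 5 ^ 2 = 5 := Real.sq_sqrt (by norm_num)
  unfold tau
  linear_combination h / 4

lemma tau_gt : 1.6 < tau := by
  have h : (2.2 : ℝ) < Real.sqrt 5 := Real.lt_sqrt_of_sq_lt (by norm_num)
  unfold tau
  linarith

lemma tau_lt : tau < 1.62 := by
  have h : Real.sqrt 5 < 2.24 := (Real.sqrt_lt' (by norm_num)).2 (by norm_num)
  unfold tau
  linarith

lemma neg_tau_div_tau_add_one : -tau / (tau + 1) = 1 - tau := by
  have := tau_gt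
  rw [div_eq_iff (by linarith)]
  linear_combination tau_sq

lemma one_div_tau_add_one : 1 / (tau + 1) = 2 - tau := by
  have := tau_gt
  rw [div_eq_iff (by linarith)]
  linear_combination tau_sq

/-- On `[l_τ, r_τ)`, the transformation `T_{-τ}` stays in this interval and uses digits `0`, `1`. -/
lemma negT_tau_mem {y : ℝ} (hy : y ∈ Set.Ico (1 - tau) (2 - tau)) :
    negT tau y ∈ Set.Ico (1 - tau) (2 - tau) ∧
      ∃ d : ℤ, (d = 0 ∨ d = 1) ∧ negT tau y = -tau * y - d := by
  have hs := tau_sq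
  have h1 := tau_gt
  have h2 := tau_lt
  obtain ⟨hl, hr⟩ := hy
  unfold negT
  rw [neg_tau_div_tau_add_one]
  set d := ⌊-tau * y - (1 - tau)⌋ with hd
  have hd1 : (d : ℝ) ≤ -tau * y - (1 - tau) := Int.floor_le _
  have hd2 : -tau * y - (1 - tau) < d + 1 := Int.lt_floor_add_one _
  refine ⟨⟨by linarith, by linarith⟩, d, ?_, rfl⟩
  have h3 : (-1 : ℝ) < d := by nlinarith
  have h4 : (d : ℝ) < 2 := by nlinarith
  have h5 : -1 < d := by exact_mod_cast h3
  have h6 : d < 2 := by exact_mod_cast h4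
  omega

lemma negT_tau_iterate_mem {y : ℝ} (hy : y ∈ Set.Ico (1 - tau) (2 - tau)) (n : ℕ) :
    (negT tau)^[n] y ∈ Set.Ico (1 - tau) (2 - tau) := by
  induction n with
  | zero => exact hy
  | succ n ih =>
    rw [Function.iterate_succ_apply']
    exact (negT_tau_mem ih).1

/-- The part of `(-τ)^n y` spelled by the first `n` digits of `y` lies in `ℤ[τ]` and its Galois
conjugate lies in `[0, τ²)`; the conjugate is at least `1` if the `n`-th iterate of `y` is `l_τ`. -/
lemma exists_conj_neg_tau_pow_mul {y : ℝ} (hy : y ∈ Set.Ico (1 - tau) (2 - tau)) (n : ℕ) :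
    ∃ a b : ℤ, (-tau) ^ n * y = (negT tau)^[n] y + (a + b * tau) ∧
      0 ≤ a + b * (1 - tau) ∧ a + b * (1 - tau) < tau ^ 2 ∧
      (n ≠ 0 → (negT tau)^[n] y = 1 - tau → 1 ≤ a + b * (1 - tau)) := by
  have hs := tau_sq
  have h1 := tau_gt
  have h2 := tau_lt
  induction n with
  | zero => exact ⟨0, 0, by simp, by simp, by simp; positivity, by simp⟩
  | succ n ih =>
    obtain ⟨a, b, hab, h0, hlt, -⟩ := ih
    have hu := negT_tau_iterate_mem hy n
    obtain ⟨-, d, hd, hT⟩ := negT_tau_mem hu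
    rw [Function.iterate_succ_apply']
    set u := (negT tau)^[n] y
    have hc : ((d - b : ℤ) : ℝ) + ((-a - b : ℤ) : ℝ) * (1 - tau)
        = d + (tau - 1) * (a + b * (1 - tau)) := by
      push_cast
      linear_combination (b : ℝ) * hs
    have hc0 : 0 ≤ (tau - 1) * (a + b * (1 - tau)) := mul_nonneg (by linarith) h0
    have hc1 : (tau - 1) * (a + b * (1 - tau)) < tau := by nlinarith
    refine ⟨d - b, -a - b, ?_, ?_⟩
    · rw [hT, pow_succ']
      push_cast
      linear_combination (-tau) * hab - (b : ℝ) * hs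
    rw [hc]
    rcases hd with rfl | rfl
    · refine ⟨by simpa using hc0, by push_cast; linarith, fun _ h => ?_⟩
      rw [hT] at h
      push_cast at h
      have := hu.2
      nlinarith
    · push_cast
      exact ⟨by linarith, by linarith, fun _ _ => by linarith⟩

/-- The only points of `ℤ[τ] ∩ [l_τ, r_τ)` whose conjugate lies in `(-τ², τ²)` are `0` and
`l_τ`. -/
lemma eq_zero_or_eq_one_sub_tau {p q : ℤ} (h : (p + q * tau : ℝ) ∈ Set.Ico (1 - tau) (2 - tau))
    (h1 : -tau ^ 2 < p + q * (1 - tau)) (h2 : p + q * (1 - tau) < tau ^ 2) :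
    p = 0 ∧ q = 0 ∨ p = 1 ∧ q = -1 := by
  have hs := tau_sq
  have g1 := tau_gt
  have g2 := tau_lt
  obtain ⟨hl, hr⟩ := h
  have q1 : (-2 : ℝ) < q := by nlinarith
  have q2 : (q : ℝ) < 2 := by nlinarith
  have q1' : -2 < q := by exact_mod_cast q1
  have q2' : q < 2 := by exact_mod_cast q2
  obtain rfl | rfl | rfl : q = -1 ∨ q = 0 ∨ q = 1 := by omega
  · push_cast at hl hr h1 h2
    have p1 : (p : ℝ) < 2 := by linarith
    have p2 : (0 : ℝ) < p := by linarith
    norm_cast at p1 p2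
    omega
  · push_cast at hl hr h1 h2
    have p1 : (p : ℝ) < 1 := by linarith
    have p2 : (-1 : ℝ) < p := by linarith
    have p1' : p < 1 := by exact_mod_cast p1
    have p2' : -1 < p := by exact_mod_cast p2
    omega
  · push_cast at hl hr h1 h2
    have p1 : (p : ℝ) < -1 := by linarith
    have p2 : (-2 : ℝ) < p := by linarith
    have p1' : p < -1 := by exact_mod_cast p1
    have p2' : -2 < p := by exact_mod_cast p2
    omega

/-- The `(-τ)`-integers form the cut-and-project set `{x ∈ ℤ[τ] : x' ∈ [0, τ²)}`. -/
lemma negInt_tau_iff (x : ℝ) :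
    negInt tau x ↔
      ∃ a b : ℤ, x = a + b * tau ∧ 0 ≤ a + b * (1 - tau) ∧ a + b * (1 - tau) < tau ^ 2 := by
  have hs := tau_sq
  have g1 := tau_gt
  have g2 := tau_lt
  unfold negInt
  rw [neg_tau_div_tau_add_one, one_div_tau_add_one]
  constructor
  · rintro (rfl | ⟨N, y, hy, rfl, h0⟩)
    · exact ⟨0, 0, by simp, by simp, by simp; positivity⟩
    · obtain ⟨a, b, hab, ha, hb, -⟩ :=
        exists_conj_neg_tau_pow_mul (Set.Ioo_subset_Ico_self hy) (N + 1)
      exact ⟨a, b, by rw [hab, h0, zero_add], ha, hb⟩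
  · rintro ⟨a, b, hx, ha, hb⟩
    obtain ⟨N, hN⟩ := pow_unbounded_of_one_lt (4 * |x|) (by linarith : 1 < tau)
    have hne : (-tau) ^ (N + 1) ≠ 0 := pow_ne_zero _ (by linarith)
    obtain ⟨y, hxy⟩ : ∃ y, x = (-tau) ^ (N + 1) * y := ⟨x / (-tau) ^ (N + 1), by field_simp⟩
    have hy : y ∈ Set.Ioo (1 - tau) (2 - tau) := by
      have hp : 0 < tau ^ N := by positivity
      have habs : |x| = tau ^ N * (tau * |y|) := by
        rw [hxy, abs_mul, abs_pow, abs_neg, abs_of_pos (by linarith : 0 < tau)]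
        ring
      rw [habs] at hN
      have h4 : 4 * (tau * |y|) < 1 := by nlinarith
      have h5 : |y| < 1 / 4 := by nlinarith [abs_nonneg y]
      rw [abs_lt] at h5
      exact ⟨by linarith, by linarith⟩
    refine Or.inr ⟨N, y, hy, hxy, ?_⟩
    have hy' := Set.Ioo_subset_Ico_self hy
    obtain ⟨c, e, hce, hc0, hc1, hc2⟩ := exists_conj_neg_tau_pow_mul hy' (N + 1)
    have hmem := negT_tau_iterate_mem hy' (N + 1)
    have hw : (negT tau)^[N + 1] y = ((a - c : ℤ) : ℝ) + ((b - e : ℤ) : ℝ) * tau := by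
      push_cast
      linear_combination hx - hxy - hce
    rw [hw] at hmem
    rcases eq_zero_or_eq_one_sub_tau hmem (by push_cast; linarith) (by push_cast; linarith)
      with ⟨hp, hq⟩ | ⟨hp, hq⟩
    · rw [hw, hp, hq]
      simp
    · have h1 := hc2 N.succ_ne_zero (by rw [hw, hp, hq]; push_cast; ring)
      obtain rfl : a = c + 1 := by omega
      obtain rfl : b = e - 1 := by omega
      push_cast at hb
      linarith

/-- For all `x, y ∈ ℤ_{-τ}`, `τ² (x + y) ∈ ℤ_{-τ}`, i.e. `L_⊕(-τ) ≤ 2`. -/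
theorem L_oplus_neg_tau_le_two
    (x y : ℝ) (hx : negInt tau x) (hy : negInt tau y) :
    negInt tau (tau ^ 2 * (x + y)) := by
  have hs := tau_sq
  have g1 := tau_gt
  rw [negInt_tau_iff] at *
  obtain ⟨a, b, rfl, ha, hb⟩ := hx
  obtain ⟨c, d, rfl, hc, hd⟩ := hy
  have hconj : ((a + c + (b + d) : ℤ) : ℝ) + ((a + c + 2 * (b + d) : ℤ) : ℝ) * (1 - tau)
      = (2 - tau) * ((a + b * (1 - tau)) + (c + d * (1 - tau))) := by
    push_cast
    linear_combination (-(b + d) : ℝ) * hs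
  refine ⟨a + c + (b + d), a + c + 2 * (b + d), ?_, ?_, ?_⟩
  · push_cast
    linear_combination (a + c + (b + d) * (tau + 1) : ℝ) * hs
  · rw [hconj]
    exact mul_nonneg (by linarith [tau_lt]) (by linarith)
  · rw [hconj]
    have := tau_lt
    nlinarith
end

section
/- Let m be an integer with m ≥ 1 and let β > 1 be the positive root of x² - mx - m. Let N ∈ ℤ and let (x_i)_{i∈ℤ} be integers with 0 ≤ x_i ≤ m for all i, x_i = 0 for all i > N, and x_i ≠ 0 for only finitely many i. Set y = Σ_{j≥1} x_{N+1-j}·(-β)^{-j}. Then the following are equivalent: (a) y ∈ (l_β, r_β) and d_j(y) = x_{N+1-j} for every j ≥ 1 (i.e., x_N x_{N-1} x_{N-2} ⋯ is the (-β)-expansion digit string); (b) there are no index i and integer k ≥ 0 such that [x_i = m, the 2k+1 entries x_{i-1}, …, x_{i-2k-1} all equal 0, and x_{i-2k-2} ≥ 1], and there is no index j such that x_{j+1} = 0, x_j = m, and x_i = 0 for all i < j (i.e., the string does not end with 0 m 0^ω). -/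
/-- If the digit `c ≥ 1` is followed by a tail of value greater than `-1`, the value is negative. -/
theorem neg_of_one_le_digit {β u v : ℝ} {c : ℤ} (hβ : 0 < β) (h : -β * u = c + v)
    (hc : 1 ≤ c) (hv : -1 < v) : u < 0 := by
  have hc' : (1 : ℝ) ≤ c := by exact_mod_cast hc
  by_contra! hu
  nlinarith [mul_nonneg hβ.le hu]

section TailValues

variable {β l : ℝ} {m M : ℤ} {x : ℤ → ℤ} {s : ℤ → ℝ}

/-- Only the zero string has value `0`. -/
theorem digits_eq_zero_of_value_eq_zero (hβ : 0 < β) (hl : -1 < l) (hx : ∀ i, 0 ≤ x i)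
    (hrec : ∀ i, -β * s i = x i + s (i - 1)) (i : ℤ) (hs : ∀ j ≤ i, l ≤ s j) (hi : s i = 0) :
    ∀ j ≤ i, x j = 0 := by
  have key : ∀ n : ℕ, s (i - n) = 0 ∧ x (i - n) = 0 := by
    have digit : ∀ j ≤ i, s j = 0 → x j = 0 := fun j hj hsj => by
      by_contra hne
      have := neg_of_one_le_digit hβ (hrec j) (by have := hx j; omega)
        (hl.trans_le (hs (j - 1) (by omega)))
      exact this.ne hsj
    intro n
    induction n with
    | zero => simpa [hi] using digit i le_rfl hi
    | succ n ih =>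
      have h := hrec (i - n)
      rw [ih.1, ih.2] at h
      have e : i - ((n + 1 : ℕ) : ℤ) = i - n - 1 := by push_cast; ring
      have hz : s (i - ((n + 1 : ℕ) : ℤ)) = 0 := by rw [e]; simpa using h.symm
      exact ⟨hz, digit _ (by omega) hz⟩
  intro j hj
  have := (key (i - j).toNat).2
  rwa [show i - ((i - j).toNat : ℤ) = j by omega] at this

/-- A string with positive value begins with an odd number of zeros followed by a nonzero digit. -/
theorem exists_odd_zeros_of_value_pos (hβ : 0 < β) (hl : -1 < l) (hx : ∀ i, 0 ≤ x i)
    (hrec : ∀ i, -β * s i = x i + s (i - 1)) (hM : ∀ i ≤ M, s i = 0) (n : ℕ) :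
    ∀ i : ℤ, i ≤ M + n → (∀ j ≤ i, l ≤ s j) → 0 < s i →
      ∃ k : ℤ, 0 ≤ k ∧ (∀ t : ℤ, 0 ≤ t → t ≤ 2 * k → x (i - t) = 0) ∧
        1 ≤ x (i - (2 * k + 1)) := by
  induction n with
  | zero =>
    intro i hi _ hpos
    exact absurd (hM i (by simpa using hi)) hpos.ne'
  | succ n ih =>
    intro i hi hs hpos
    have hx0 : x i = 0 := by
      by_contra hne
      have := neg_of_one_le_digit hβ (hrec i) (by have := hx i; omega)
        (hl.trans_le (hs (i - 1) (by omega)))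
      linarith
    by_cases hx1 : 1 ≤ x (i - 1)
    · refine ⟨0, le_rfl, fun t h0 h1 => ?_, by simpa using hx1⟩
      rwa [show t = 0 by omega, sub_zero]
    have hx1' : x (i - 1) = 0 := by have := hx (i - 1); omega
    have h0 := hrec i
    have h1 := hrec (i - 1)
    rw [hx0] at h0
    rw [hx1', show i - 1 - 1 = i - 2 by ring] at h1
    push_cast at h0 h1
    have hneg : s (i - 1) < 0 := by nlinarith [mul_pos hβ hpos]
    have hpos2 : 0 < s (i - 2) := by nlinarith [mul_pos hβ (neg_pos.2 hneg)]
    obtain ⟨k, hk, hz, ho⟩ := ih (i - 2) (by push_cast at hi; omega)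
      (fun j hj => hs j (by omega)) hpos2
    refine ⟨k + 1, by omega, fun t ht0 ht1 => ?_, ?_⟩
    · rcases (by omega : t = 0 ∨ t = 1 ∨ 2 ≤ t) with rfl | rfl | ht
      · simpa using hx0
      · exact hx1'
      · have := hz (t - 2) (by omega) (by omega)
        rwa [show i - 2 - (t - 2) = i - t by ring] at this
    · rwa [show i - 2 - (2 * k + 1) = i - (2 * (k + 1) + 1) by ring] at ho

/-- An odd number of zeros followed by a string of negative value has positive value. -/
theorem value_pos_of_odd_zeros (hβ : 0 < β) (hrec : ∀ i, -β * s i = x i + s (i - 1)) (n : ℕ) :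
    ∀ i : ℤ, (∀ t : ℤ, 0 ≤ t → t ≤ 2 * n → x (i - t) = 0) → s (i - (2 * n + 1)) < 0 →
      0 < s i := by
  have step : ∀ i, x i = 0 → -β * s i = s (i - 1) := fun i h => by simpa [h] using hrec i
  induction n with
  | zero =>
    intro i hz hneg
    have h := step i (by simpa using hz 0 le_rfl le_rfl)
    rw [Nat.cast_zero, mul_zero, zero_add] at hneg
    by_contra! hc
    nlinarith
  | succ n ih =>
    intro i hz hneg
    push_cast at hz hneg
    have h0 := step i (by simpa using hz 0 le_rfl (by omega))
    have h1 := step (i - 1) (hz 1 (by omega) (by omega))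
    rw [show i - 1 - 1 = i - 2 by ring] at h1
    have hpos : 0 < s (i - 2) := by
      refine ih (i - 2) (fun t ht0 ht1 => ?_) ?_
      · have := hz (t + 2) (by omega) (by omega)
        rwa [show i - (t + 2) = i - 2 - t by ring] at this
      · rwa [show i - 2 - (2 * (n : ℤ) + 1) = i - (2 * (n + 1) + 1) by ring]
    have hneg1 : s (i - 1) < 0 := by
      by_contra! hc
      nlinarith
    by_contra! hc
    nlinarith

/-- All tail values lie in `[l, l + 1)` if and only if the digit string avoids the forbidden
patterns. -/
theorem forall_value_mem_Ico_iff (hβ : 0 < β) (hl : -1 < l) (hl0 : l < 0)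
    (hr : β * (l + 1) = -l) (hm : β * l = -m) (hx : ∀ i, 0 ≤ x i ∧ x i ≤ m)
    (hrec : ∀ i, -β * s i = x i + s (i - 1)) (hM : ∀ i ≤ M, s i = 0) :
    (∀ i, s i ∈ Set.Ico l (l + 1)) ↔
    ((¬ ∃ (i k : ℤ), 0 ≤ k ∧ x i = m ∧
          (∀ t : ℤ, 1 ≤ t → t ≤ 2 * k + 1 → x (i - t) = 0) ∧ 1 ≤ x (i - (2 * k + 2))) ∧
     (¬ ∃ j : ℤ, x (j + 1) = 0 ∧ x j = m ∧ ∀ i : ℤ, i < j → x i = 0)) := by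
  constructor
  · intro h
    refine ⟨?_, ?_⟩
    · rintro ⟨i, k, hk, hi, hz, ho⟩
      lift k to ℕ using hk
      have hneg : s (i - (2 * k + 2)) < 0 :=
        neg_of_one_le_digit hβ (hrec _) ho (hl.trans_le (h _).1)
      have hpos : 0 < s (i - 1) := by
        refine value_pos_of_odd_zeros hβ hrec k (i - 1) (fun t ht0 ht1 => ?_) ?_
        · have := hz (t + 1) (by omega) (by omega)
          rwa [show i - (t + 1) = i - 1 - t by ring] at this
        · rwa [show i - 1 - (2 * (k : ℤ) + 1) = i - (2 * k + 2) by ring]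
      have h1 := hrec i
      rw [hi] at h1
      nlinarith [mul_nonneg hβ.le (sub_nonneg.2 (h i).1)]
    · rintro ⟨j, h1, hj, hz⟩
      have hs : s (j - 1) = 0 := by
        by_contra hne
        have zeros : ∀ n : ℕ, s (j - 1 - n) ≠ 0 := by
          intro n
          induction n with
          | zero => simpa using hne
          | succ n ih =>
            have h := hrec (j - 1 - n)
            rw [hz _ (by omega), show j - 1 - (n : ℤ) - 1 = j - 1 - ((n + 1 : ℕ) : ℤ) by
              push_cast; ring, Int.cast_zero, zero_add] at h
            rw [← h]
            exact mul_ne_zero (neg_ne_zero.2 hβ.ne') ih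
        exact zeros (j - 1 - M).toNat (hM _ (by omega))
      have e1 := hrec j
      have e2 := hrec (j + 1)
      rw [hj, hs] at e1
      rw [h1, add_sub_cancel_right, Int.cast_zero, zero_add] at e2
      have hsj : s j = l := mul_left_cancel₀ hβ.ne' (by linarith)
      have : s (j + 1) = l + 1 := mul_left_cancel₀ hβ.ne' (by linarith)
      exact (h (j + 1)).2.ne this
  · rintro ⟨hA, hB⟩
    have key : ∀ n : ℕ, ∀ j ≤ M + n, s j ∈ Set.Ico l (l + 1) := by
      intro n
      induction n with
      | zero =>
        intro j hj
        rw [hM j (by simpa using hj)]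
        exact ⟨hl0.le, by linarith⟩
      | succ n ih =>
        intro j hj
        push_cast at hj
        have hlow : ∀ i ≤ j - 1, l ≤ s i := fun i hi => (ih i (by omega)).1
        have hprev := ih (j - 1) (by omega)
        have upper : (x j : ℝ) + s (j - 1) ≤ m := by
          rcases (hx j).2.lt_or_eq with hlt | heq
          · have : (x j : ℝ) + 1 ≤ m := by exact_mod_cast hlt
            linarith [hprev.2]
          · have : s (j - 1) ≤ 0 := by
              by_contra! hpos
              obtain ⟨k, hk, hz, ho⟩ := exists_odd_zeros_of_value_pos hβ hl (fun i => (hx i).1)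
                hrec hM n (j - 1) (by omega) hlow hpos
              refine hA ⟨j, k, hk, heq, fun t ht0 ht1 => ?_, ?_⟩
              · have := hz (t - 1) (by omega) (by omega)
                rwa [show j - 1 - (t - 1) = j - t by ring] at this
              · rwa [show j - 1 - (2 * k + 1) = j - (2 * k + 2) by ring] at ho
            rw [heq]
            linarith
        have lower : l < (x j : ℝ) + s (j - 1) := by
          rcases (hx j).1.lt_or_eq with hgt | heq
          · have : (1 : ℝ) ≤ x j := by exact_mod_cast hgt
            linarith [hprev.1]
          · rw [← heq, Int.cast_zero, zero_add]
            refine lt_of_le_of_ne hprev.1 fun hsl => ?_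
            have e := hrec (j - 1)
            have hp2 := ih (j - 1 - 1) (by omega)
            have hxm : x (j - 1) = m := by
              have : (m : ℝ) < x (j - 1) + 1 := by
                rw [← hsl] at e
                nlinarith [hp2.2]
              have : m < x (j - 1) + 1 := by exact_mod_cast this
              have := (hx (j - 1)).2
              omega
            have hs0 : s (j - 1 - 1) = 0 := by
              rw [← hsl, hxm] at e
              linarith
            refine hB ⟨j - 1, by simpa using heq.symm, hxm, fun i hi => ?_⟩
            exact digits_eq_zero_of_value_eq_zero hβ hl (fun i => (hx i).1) hrec (j - 1 - 1)
              (fun i hi => hlow i (by omega)) hs0 i (by omega)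
        have e := hrec j
        constructor
        · by_contra! hc
          nlinarith [mul_pos hβ (sub_pos.2 hc)]
        · by_contra! hc
          nlinarith [mul_nonneg hβ.le (sub_nonneg.2 hc)]
    exact fun i => key (i - M).toNat i (by omega)

end TailValues

/-- If `-β * s i = x i + s (i - 1)` for all `i`, with leading zeros beyond `N`, then
`x N, x (N - 1), …` are the `(-β)`-digits of `s N ∈ (l, r)` if and only if all tail values
`s i` lie in `[l, r)`. -/
theorem mem_Ioo_and_negDigit_eq_iff {β : ℝ} (hβ : 1 < β) {N : ℤ} {x : ℤ → ℤ} {s : ℤ → ℝ}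
    (htop : ∀ i, N < i → x i = 0) (hrec : ∀ i, -β * s i = x i + s (i - 1)) :
    (s N ∈ Set.Ioo (-β / (β + 1)) (1 / (β + 1)) ∧ ∀ j : ℕ, negDigit β (s N) j = x (N - j)) ↔
      ∀ i, s i ∈ Set.Ico (-β / (β + 1)) (-β / (β + 1) + 1) := by
  have hb : 0 < β + 1 := by linarith
  have hlr : 1 / (β + 1) = -β / (β + 1) + 1 := by field_simp; ring
  have hr : β * (-β / (β + 1) + 1) = -(-β / (β + 1)) := by field_simp; ring
  have hl : -1 < -β / (β + 1) := by rw [lt_div_iff₀ hb]; linarith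
  have hl0 : -β / (β + 1) < 0 := div_neg_of_neg_of_pos (by linarith) hb
  have hT : ∀ u, negT β u = -β * u - (⌊-β * u - (-β / (β + 1))⌋ : ℝ) := fun u => rfl
  rw [hlr]
  set l := -β / (β + 1) with hldef
  have hfloor : ∀ i, ⌊-β * s i - l⌋ = x i ↔ s (i - 1) ∈ Set.Ico l (l + 1) := fun i => by
    rw [Int.floor_eq_iff, hrec i, Set.mem_Ico]
    constructor <;> rintro ⟨h1, h2⟩ <;> constructor <;> linarith
  have hdig : ∀ j : ℕ, (negT β)^[j] (s N) = s (N - j) →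
      negDigit β (s N) j = ⌊-β * s (N - j) - l⌋ := fun j hj => by
    rw [negDigit, hj]
  have hnext : ∀ j : ℕ, (negT β)^[j] (s N) = s (N - j) → ⌊-β * s (N - j) - l⌋ = x (N - j) →
      (negT β)^[j + 1] (s N) = s (N - (j + 1 : ℕ)) := fun j hj hf => by
    rw [Function.iterate_succ_apply', hj, hT, hf, hrec]
    push_cast
    rw [show N - ((j : ℤ) + 1) = N - j - 1 by ring]
    ring
  constructor
  · rintro ⟨hN, hd⟩
    have orbit : ∀ j : ℕ, (negT β)^[j] (s N) = s (N - j) := by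
      intro j
      induction j with
      | zero => simp
      | succ j ih => exact hnext j ih ((hdig j ih).symm.trans (hd j))
    have above : ∀ j : ℕ, s (N + j) ∈ Set.Ioo l (l + 1) := by
      intro j
      induction j with
      | zero => simpa using hN
      | succ j ih =>
        have e := hrec (N + (j + 1 : ℕ))
        rw [htop _ (by push_cast; omega), show N + ((j + 1 : ℕ) : ℤ) - 1 = N + j by
          push_cast; ring, Int.cast_zero, zero_add] at e
        have h1 := ih.1
        have h2 := ih.2
        constructor
        · by_contra! hc
          nlinarith
        · by_contra! hc
          nlinarith
    intro i
    rcases le_or_gt N i with h | h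
    · have := above (i - N).toNat
      rw [show N + ((i - N).toNat : ℤ) = i by omega] at this
      exact ⟨this.1.le, this.2⟩
    · have e : N - ((N - i - 1).toNat : ℤ) = i + 1 := by omega
      have := (hdig _ (orbit (N - i - 1).toNat)).symm.trans (hd _)
      rw [e, hfloor, add_sub_cancel_right] at this
      exact this
  · intro h
    have orbit : ∀ j : ℕ, (negT β)^[j] (s N) = s (N - j) := by
      intro j
      induction j with
      | zero => simp
      | succ j ih => exact hnext j ih ((hfloor _).2 (h _))
    refine ⟨⟨lt_of_le_of_ne (h N).1 fun hN => ?_, (h N).2⟩,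
      fun j => (hdig j (orbit j)).trans ((hfloor _).2 (h _))⟩
    have e := hrec (N + 1)
    rw [htop _ (by omega), add_sub_cancel_right, ← hN, Int.cast_zero, zero_add] at e
    have : s (N + 1) = l + 1 := mul_left_cancel₀ (by linarith : β ≠ 0) (by linarith)
    exact (h (N + 1)).2.ne this

/-- Shifting a finitely supported digit string by one place multiplies its value by `-β`. -/
theorem neg_mul_tsum_digits {β : ℝ} (hβ : β ≠ 0) {x : ℤ → ℤ} (hfin : {i | x i ≠ 0}.Finite)
    (i : ℤ) :
    -β * ∑' j : ℕ, (x (i - (j : ℤ)) : ℝ) * (-β) ^ (-(j + 1) : ℤ) =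
      x i + ∑' j : ℕ, (x (i - 1 - (j : ℤ)) : ℝ) * (-β) ^ (-(j + 1) : ℤ) := by
  have hb : -β ≠ 0 := neg_ne_zero.2 hβ
  have hsum : Summable fun j : ℕ => (x (i - (j : ℤ)) : ℝ) * (-β) ^ (-(j + 1) : ℤ) := by
    refine summable_of_hasFiniteSupport ?_
    refine (hfin.preimage (f := fun j : ℕ => i - (j : ℤ)) fun a _ b _ h => ?_).subset ?_
    · simpa using h
    · intro j hj hx
      exact hj (by simp only [hx, Int.cast_zero, zero_mul])
  rw [hsum.tsum_eq_zero_add, mul_add, ← tsum_mul_left]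
  congr 1
  · simp only [Nat.cast_zero, sub_zero, zero_add, zpow_neg, zpow_one]
    field_simp
  · refine tsum_congr fun j => ?_
    rw [show (-((j : ℤ) + 1)) = 1 + -(((j + 1 : ℕ) : ℤ) + 1) by push_cast; ring, zpow_one_add₀ hb,
      show i - ((j + 1 : ℕ) : ℤ) = i - 1 - j by push_cast; ring]
    ring

/-- admissibility criterion for `(-β)`-expansions, case `m = n ≥ 1`,
`β > 1` the positive root of `x² - mx - m`.  Here `y = Σ_{j≥1} x_{N+1-j} (-β)^{-j}`
and `negDigit β y j = d_{j+1}(y)`, so condition (a) reads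
`y ∈ (l_β, r_β)` and `d_{j+1}(y) = x_{N-j}` for all `j ∈ ℕ`. -/
theorem admissibility_criterion_m_eq_n
    (m : ℤ) (hm : 1 ≤ m) (β : ℝ) (hβ : 1 < β)
    (hroot : β ^ 2 - (m : ℝ) * β - (m : ℝ) = 0)
    (N : ℤ) (x : ℤ → ℤ)
    (hbound : ∀ i : ℤ, 0 ≤ x i ∧ x i ≤ m)
    (htop : ∀ i : ℤ, N < i → x i = 0)
    (hfin : {i : ℤ | x i ≠ 0}.Finite)
    (y : ℝ) (hy : y = ∑' j : ℕ, (x (N - (j : ℤ)) : ℝ) * (-β) ^ (-(j + 1) : ℤ)) :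
    (y ∈ Set.Ioo (-β / (β + 1)) (1 / (β + 1)) ∧
        ∀ j : ℕ, negDigit β y j = x (N - (j : ℤ)))
      ↔
    ((¬ ∃ (i k : ℤ), 0 ≤ k ∧ x i = m ∧
          (∀ t : ℤ, 1 ≤ t → t ≤ 2 * k + 1 → x (i - t) = 0) ∧ 1 ≤ x (i - (2 * k + 2))) ∧
     (¬ ∃ j : ℤ, x (j + 1) = 0 ∧ x j = m ∧ ∀ i : ℤ, i < j → x i = 0)) := by
  have hb : 0 < β + 1 := by linarith
  have hβ0 : β ≠ 0 := by linarith
  set s : ℤ → ℝ := fun i => ∑' j : ℕ, (x (i - (j : ℤ)) : ℝ) * (-β) ^ (-(j + 1) : ℤ) with hs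
  have hrec : ∀ i, -β * s i = x i + s (i - 1) := neg_mul_tsum_digits hβ0 hfin
  obtain ⟨M, hM⟩ : ∃ M : ℤ, ∀ i ≤ M, s i = 0 := by
    obtain ⟨L, hL⟩ := hfin.bddBelow
    refine ⟨L - 1, fun i hi => ?_⟩
    have hx : ∀ j : ℕ, x (i - (j : ℤ)) = 0 := fun j => by
      by_contra hne
      have := hL hne
      omega
    simp [hs, hx]
  have hyN : y = s N := hy
  rw [hyN, mem_Ioo_and_negDigit_eq_iff hβ htop hrec]
  refine forall_value_mem_Ico_iff (by linarith) ?_ ?_ ?_ ?_ hbound hrec hM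
  · rw [lt_div_iff₀ hb]
    linarith
  · exact div_neg_of_neg_of_pos (by linarith) hb
  · field_simp
    ring
  · field_simp
    linarith
end

section
/- Let m, n be integers with m ≥ n ≥ 1 and let β > 1 be the positive root of x² - mx - n. Then -1 ∉ Fin(-β). In particular, since 0 and 1 belong to Fin(-β), the set Fin(-β) is not closed under subtraction. -/
theorem negT_eq_of_mem_Ico_s9 {β x : ℝ} (hβ : 1 < β) (d : ℤ)
    (h : -β * x - d ∈ Set.Ico (-β / (β + 1)) (1 / (β + 1))) : negT β x = -β * x - d := by
  have hr : 1 / (β + 1) = -β / (β + 1) + 1 := by field_simp; ring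
  obtain ⟨h1, h2⟩ := h
  have hd : ⌊-β * x - (-β / (β + 1))⌋ = d := by
    rw [Int.floor_eq_iff]
    constructor <;> linarith
  rw [negT, hd]

theorem negT_neg_inv {β : ℝ} (hβ : 1 < β) : negT β (-β⁻¹) = 0 := by
  have h0 : -β * -β⁻¹ - ((1 : ℤ) : ℝ) = 0 := by push_cast; field_simp; ring
  rw [negT_eq_of_mem_Ico_s9 hβ 1, h0]
  rw [h0, Set.mem_Ico, div_le_iff₀ (by linarith), lt_div_iff₀ (by linarith)]
  constructor <;> linarith

/-- Multiplication by a negative power of `-β` with exponent at most `-2` brings `-1` into the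
open interval `(l_β, r_β)`. -/
theorem neg_zpow_mem_Ioo {β : ℝ} (hβ : 1 < β) (hsq : β + 1 ≤ β ^ 2) (j : ℕ) :
    -(-β) ^ (-2 - j : ℤ) ∈ Set.Ioo (-β / (β + 1)) (1 / (β + 1)) := by
  have hb : 0 < β := by linarith
  have hodd : 1 / β ^ 3 < 1 / (β + 1) := one_div_lt_one_div_of_lt (by linarith) (by nlinarith)
  have heven : 1 / β ^ 2 < β / (β + 1) := by
    rw [div_lt_div_iff₀ (by positivity) (by positivity)]; nlinarith
  have hpow : (-β) ^ (-2 - j : ℤ) = ((-β) ^ (j + 2))⁻¹ := by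
    rw [← zpow_natCast, ← zpow_neg]; congr 1; push_cast; ring
  have hl : -β / (β + 1) = -(β / (β + 1)) := neg_div _ _
  have hr : 0 < 1 / (β + 1) := by positivity
  have hl' : 0 < β / (β + 1) := by positivity
  rw [hpow, Set.mem_Ioo, hl]
  rcases Nat.even_or_odd (j + 2) with h | h
  · rw [h.neg_pow]
    have hle : (β ^ (j + 2))⁻¹ ≤ 1 / β ^ 2 := by
      rw [one_div]
      exact inv_anti₀ (by positivity) (pow_le_pow_right₀ hβ.le (by omega))
    have : 0 < (β ^ (j + 2))⁻¹ := by positivity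
    constructor <;> linarith
  · rw [h.neg_pow, inv_neg, neg_neg]
    have hj : 3 ≤ j + 2 := by obtain ⟨t, ht⟩ := h; omega
    have hle : (β ^ (j + 2))⁻¹ ≤ 1 / β ^ 3 := by
      rw [one_div]
      exact inv_anti₀ (by positivity) (pow_le_pow_right₀ hβ.le hj)
    have : 0 < (β ^ (j + 2))⁻¹ := by positivity
    constructor <;> linarith

theorem negFin_one {β : ℝ} (hβ : 1 < β) (hsq : β + 1 ≤ β ^ 2) : negFin β 1 := by
  have hb : 0 < β := by linarith
  rcases hsq.lt_or_eq with h | h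
  · refine ⟨-1, 1, ?_, ?_⟩
    · rw [zpow_neg_one, mul_one, inv_neg, Set.mem_Ioo, neg_div, neg_lt_neg_iff, inv_eq_one_div,
        div_lt_div_iff₀ hb (by linarith)]
      refine ⟨by nlinarith, ?_⟩
      have : 0 < 1 / β := by positivity
      have : 0 < 1 / (β + 1) := by positivity
      linarith
    · rw [zpow_neg_one, mul_one, inv_neg]
      exact negT_neg_inv hβ
  · have hx : (-β) ^ (-3 : ℤ) * 1 = -(β ^ 3)⁻¹ := by
      rw [mul_one, zpow_neg, show (3 : ℤ) = (3 : ℕ) from rfl, zpow_natCast,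
        Odd.neg_pow (by decide), inv_neg]
    refine ⟨-3, 2, ?_, ?_⟩
    · have h1 : 1 / β ^ 3 < β / (β + 1) := by
        rw [← h.symm, div_lt_div_iff₀ (by positivity) (by positivity)]; nlinarith
      rw [hx, Set.mem_Ioo, neg_div, neg_lt_neg_iff, inv_eq_one_div]
      have : 0 < 1 / β ^ 3 := by positivity
      have : 0 < 1 / (β + 1) := by positivity
      exact ⟨h1, by linarith⟩
    · have h1 : -β * -(β ^ 3)⁻¹ - ((1 : ℤ) : ℝ) = -β⁻¹ := by
        push_cast; field_simp; linarith
      have h2 : negT β (-(β ^ 3)⁻¹) = -β⁻¹ := by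
        rw [negT_eq_of_mem_Ico_s9 hβ 1, h1]
        have : -β / (β + 1) = -β⁻¹ := by rw [h]; field_simp
        have : 0 < 1 / (β + 1) := by positivity
        have : 0 < β⁻¹ := by positivity
        rw [h1]
        constructor <;> linarith
      rw [hx, Function.iterate_succ_apply, Function.iterate_one, h2]
      exact negT_neg_inv hβ

theorem le_neg_two_of_zpow_mem_Ioo {β : ℝ} (hβ : 1 < β) {k : ℤ}
    (h : (-β) ^ k * (-1) ∈ Set.Ioo (-β / (β + 1)) (1 / (β + 1))) : k ≤ -2 := by
  have hb : 0 < β := by linarith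
  by_contra! hk
  obtain rfl | hk : k = -1 ∨ 0 ≤ k := by omega
  · have h2 := h.2
    rw [zpow_neg_one, inv_neg, neg_mul_neg, mul_one, inv_eq_one_div,
      one_div_lt_one_div hb (by linarith)] at h2
    linarith
  · have h1 : 1 ≤ |(-β) ^ k * (-1)| := by
      rw [abs_mul, abs_zpow, abs_neg, abs_neg, abs_one, mul_one, abs_of_pos hb]
      exact one_le_zpow₀ hβ.le hk
    have hl : -1 < -β / (β + 1) := by rw [lt_div_iff₀ (by linarith)]; linarith
    have hr : 1 / (β + 1) < 1 := by rw [div_lt_iff₀ (by linarith)]; linarith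
    exact absurd (abs_lt.2 ⟨hl.trans h.1, h.2.trans hr⟩) h1.not_gt

theorem not_negFin_neg_one {m n : ℤ} {β : ℝ} (hn : 1 ≤ n) (hmn : n ≤ m) (hβ : 1 < β)
    (hroot : β ^ 2 - (m : ℝ) * β - (n : ℝ) = 0) (hsq : β + 1 ≤ β ^ 2) : ¬ negFin β (-1) := by
  have hb : 0 < β := by linarith
  have hn' : (1 : ℝ) ≤ n := by exact_mod_cast hn
  have hmn' : (n : ℝ) ≤ m := by exact_mod_cast hmn
  have hnβ : (n : ℝ) < β := by nlinarith
  have hβm : β - m = n / β := by field_simp; linarith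
  have mem_of_one_le {t : ℝ} (h1 : 1 ≤ t) (h2 : t < β) :
      t / β - 1 ∈ Set.Ico (-β / (β + 1)) (1 / (β + 1)) := by
    have hlow : 1 / (β + 1) ≤ t / β := by
      rw [div_le_div_iff₀ (by linarith) hb]; nlinarith
    have hup : t / β < 1 := (div_lt_one hb).2 h2
    have hl : -β / (β + 1) = 1 / (β + 1) - 1 := by field_simp; ring
    have : 0 < 1 / (β + 1) := by positivity
    constructor <;> linarith
  have step (x t : ℝ) (d : ℤ) (h1 : 1 ≤ t) (h2 : t < β) (hx : -β * x - d = t / β - 1) :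
      negT β x = t / β - 1 := by
    rw [negT_eq_of_mem_Ico_s9 hβ d (hx ▸ mem_of_one_le h1 h2), hx]
  let S : Set ℝ := {x | (∃ j : ℕ, x = -(-β) ^ (-2 - j : ℤ)) ∨ x = 1 / β - 1 ∨ x = n / β - 1}
  have hS : Set.MapsTo (negT β) S S := by
    rintro x (⟨j, rfl⟩ | rfl | rfl)
    · cases j with
      | zero =>
        refine Or.inr (Or.inl (step _ 1 1 le_rfl hβ ?_))
        have : (-β) ^ (-2 - (0 : ℕ) : ℤ) = (β ^ 2)⁻¹ := by
          rw [show (-2 - (0 : ℕ) : ℤ) = -(2 : ℕ) by rfl, zpow_neg, zpow_natCast, neg_sq]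
        rw [this]
        push_cast
        field_simp
      | succ j =>
        refine Or.inl ⟨j, ?_⟩
        have hx : -β * -(-β) ^ (-2 - (j + 1 : ℕ) : ℤ) - ((0 : ℤ) : ℝ)
            = -(-β) ^ (-2 - j : ℤ) := by
          rw [show (-2 - j : ℤ) = 1 + (-2 - (j + 1 : ℕ)) by push_cast; ring,
            zpow_one_add₀ (neg_ne_zero.2 hb.ne')]
          push_cast
          ring
        rw [negT_eq_of_mem_Ico_s9 hβ 0, hx]
        rw [hx]
        exact Set.Ioo_subset_Ico_self (neg_zpow_mem_Ioo hβ hsq j)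
    · refine Or.inr (Or.inr (step _ n m hn' hnβ ?_))
      rw [← hβm]
      field_simp
      ring
    · refine Or.inr (Or.inr (step _ n (m + 1 - n) hn' hnβ ?_))
      rw [mul_sub, mul_div_assoc', neg_mul, neg_div, mul_div_cancel_left₀ _ hb.ne', ← hβm]
      push_cast
      ring
  have hS0 : (0 : ℝ) ∉ S := by
    rintro (⟨j, hj⟩ | h | h)
    · exact zpow_ne_zero _ (neg_ne_zero.2 hb.ne') (neg_eq_zero.1 hj.symm)
    · have := (div_lt_one hb).2 hβ
      linarith
    · have := (div_lt_one hb).2 hnβ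
      linarith
  rintro ⟨k, N, hk, hN⟩
  have hk2 := le_neg_two_of_zpow_mem_Ioo hβ hk
  obtain ⟨j, hj⟩ := Int.eq_ofNat_of_zero_le (show 0 ≤ -2 - k by omega)
  have hmem : (-β) ^ k * (-1) ∈ S := Or.inl ⟨j, by rw [show k = -2 - j by omega]; ring⟩
  exact hS0 (hN ▸ hS.iterate N hmem)

/-- For `β > 1` the positive root of `x² - mx - n`, `m ≥ n ≥ 1`,
we have `0, 1 ∈ Fin(-β)` but `-1 ∉ Fin(-β)`; in particular `Fin(-β)` is not closed
under subtraction. -/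
theorem neg_one_not_in_negFin
    (m n : ℤ) (hn : 1 ≤ n) (hmn : n ≤ m) (β : ℝ) (hβ : 1 < β)
    (hroot : β ^ 2 - (m : ℝ) * β - (n : ℝ) = 0) :
    negFin β 0 ∧ negFin β 1 ∧ ¬ negFin β (-1) := by
  have hn' : (1 : ℝ) ≤ n := by exact_mod_cast hn
  have hm' : (1 : ℝ) ≤ m := by exact_mod_cast hn.trans hmn
  have hsq : β + 1 ≤ β ^ 2 := by nlinarith
  refine ⟨⟨0, 0, ?_, by simp⟩, negFin_one hβ hsq, not_negFin_neg_one hn hmn hβ hroot hsq⟩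
  rw [mul_zero, Set.mem_Ioo, div_lt_iff₀ (by linarith), lt_div_iff₀ (by linarith)]
  constructor <;> linarith
end
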